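/- arXiv:math/0304496 — 4 statements merged into one kernel-verified Lean document; each statement's English description precedes it below -/
import Mathlib

section
/- Let g be a positive integer and let (k_n) be a sequence of positive integers with k_n ≤ n for all n and k_n = o(n^{g/(2g+2)}), i.e., lim_{n→∞} k_n / n^{g/(2g+2)} = 0. Then lim_{n→∞} B_2[g](k_n, n) / C(n, k_n) = 1. -/
/-- `repFn A h m` is the representation function `r_{A,h}(m)`: the number (as an
extended natural number) of nondecreasing `h`-tuples `(a_1, …, a_h)` of elements of `A`
with `a_1 + ⋯ + a_h = m`. -/
noncomputable def repFn (A : Set ℤ) (h : ℕ) (m : ℤ) : ℕ∞ :=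
  {f : Fin h → ℤ | (∀ i, f i ∈ A) ∧ Monotone f ∧ ∑ i, f i = m}.encard

/-- `A` is a `B_h[g]`-set: every integer has at most `g` representations as a sum of
`h` nondecreasing elements of `A`. -/
def IsBhg (A : Set ℤ) (h g : ℕ) : Prop := ∀ m : ℤ, repFn A h m ≤ (g : ℕ∞)

/-- `countBhg h g k n` is the number of `B_h[g]`-sets of cardinality `k`
contained in `{1, 2, …, n}`. -/
noncomputable def countBhg (h g k n : ℕ) : ℕ :=
  Set.ncard {A : Finset ℤ | ↑A ⊆ Set.Icc (1 : ℤ) (n : ℤ) ∧ A.card = k ∧ IsBhg ↑A h g}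

section

open Finset

/-- The number of `k`-subsets of `s` containing a fixed subset `T`. -/
theorem card_filter_subset_powersetCard {α : Type*} [DecidableEq α] (s T : Finset α) (k : ℕ)
    (hT : T ⊆ s) (hk : #T ≤ k) :
    #{A ∈ s.powersetCard k | T ⊆ A} = (#s - #T).choose (k - #T) := by
  rw [← card_sdiff_of_subset hT, ← card_powersetCard]
  refine card_bij' (fun A _ => A \ T) (fun B _ => B ∪ T) ?_ ?_ ?_ ?_
  · intro A hA
    simp only [mem_filter, mem_powersetCard] at hA ⊢
    exact ⟨sdiff_subset_sdiff hA.1.1 le_rfl, by rw [card_sdiff_of_subset hA.2, hA.1.2]⟩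
  · intro B hB
    simp only [mem_filter, mem_powersetCard] at hB ⊢
    have hd : Disjoint B T := disjoint_of_subset_left hB.1 sdiff_disjoint
    refine ⟨⟨union_subset (hB.1.trans sdiff_subset) hT, ?_⟩, subset_union_right⟩
    rw [card_union_of_disjoint hd, hB.2]
    omega
  · intro A hA
    simp only [mem_filter] at hA
    exact sdiff_union_of_subset hA.2
  · intro B hB
    simp only [mem_powersetCard] at hB
    have hd : Disjoint B T := disjoint_of_subset_left hB.1 sdiff_disjoint
    rw [union_sdiff_right, sdiff_eq_self_of_disjoint hd]

theorem choose_sub_sub_mul_pow_le {n k : ℕ} (hkn : k ≤ n) (t : ℕ) (ht : t ≤ k) :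
    (n - t).choose (k - t) * n ^ t ≤ n.choose k * k ^ t := by
  induction t with
  | zero => simp
  | succ t ih =>
    obtain ⟨j, rfl⟩ : ∃ j, k = j + t + 1 := ⟨k - (t + 1), by omega⟩
    obtain ⟨i, rfl⟩ : ∃ i, n = i + t + 1 := ⟨n - (t + 1), by omega⟩
    have ih := ih (by omega)
    have e1 : i + t + 1 - t = i + 1 := by omega
    have e2 : j + t + 1 - t = j + 1 := by omega
    have e3 : i + t + 1 - (t + 1) = i := by omega
    have e4 : j + t + 1 - (t + 1) = j := by omega
    rw [e1, e2] at ih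
    rw [e3, e4]
    have h1 : (i + 1) * i.choose j = (i + 1).choose (j + 1) * (j + 1) :=
      Nat.add_one_mul_choose_eq i j
    have h2 : i.choose j ≤ (i + 1).choose (j + 1) := by
      rw [Nat.choose_succ_succ]; exact Nat.le_add_right _ _
    have h3 : i.choose j * (i + t + 1) ≤ (i + 1).choose (j + 1) * (j + t + 1) := by
      nlinarith [Nat.mul_le_mul_left t h2]
    calc i.choose j * (i + t + 1) ^ (t + 1)
        = (i.choose j * (i + t + 1)) * (i + t + 1) ^ t := by ring
      _ ≤ ((i + 1).choose (j + 1) * (j + t + 1)) * (i + t + 1) ^ t := by gcongr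
      _ = ((i + 1).choose (j + 1) * (i + t + 1) ^ t) * (j + t + 1) := by ring
      _ ≤ ((i + t + 1).choose (j + t + 1) * (j + t + 1) ^ t) * (j + t + 1) := by gcongr
      _ = _ := by ring

theorem card_filter_subset_powersetCard_mul_pow_le {α : Type*} [DecidableEq α]
    (s T : Finset α) {k : ℕ} (hk : k ≤ #s) :
    #{A ∈ s.powersetCard k | T ⊆ A} * #s ^ #T ≤ (#s).choose k * k ^ #T := by
  by_cases h : T ⊆ s ∧ #T ≤ k
  · rw [card_filter_subset_powersetCard s T k h.1 h.2]
    exact choose_sub_sub_mul_pow_le hk _ h.2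
  · rw [filter_eq_empty_iff.2, card_empty, zero_mul]
    · exact Nat.zero_le _
    · intro A hA hTA
      rw [mem_powersetCard] at hA
      exact h ⟨hTA.trans hA.1, hA.2 ▸ card_le_card hTA⟩

/-- Union bound: the number of `k`-subsets of `s` containing some member, of size `t`, of a
family indexed by `I`. -/
theorem card_filter_exists_subset_mul_pow_le {α ι : Type*} [DecidableEq α]
    (s : Finset α) {k : ℕ} (hk : k ≤ #s) (I : Finset ι) (S : ι → Finset α) (t : ℕ) :
    #{A ∈ s.powersetCard k | ∃ i ∈ I, #(S i) = t ∧ S i ⊆ A} * #s ^ t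
      ≤ #I * ((#s).choose k * k ^ t) := by
  classical
  have hsub : {A ∈ s.powersetCard k | ∃ i ∈ I, #(S i) = t ∧ S i ⊆ A} ⊆
      {i ∈ I | #(S i) = t}.biUnion fun i => {A ∈ s.powersetCard k | S i ⊆ A} := by
    intro A hA
    obtain ⟨hA, i, hi, ht, hS⟩ := mem_filter.1 hA
    exact mem_biUnion.2 ⟨i, mem_filter.2 ⟨hi, ht⟩, mem_filter.2 ⟨hA, hS⟩⟩
  calc _ ≤ (∑ i ∈ I with #(S i) = t, #{A ∈ s.powersetCard k | S i ⊆ A}) * #s ^ t :=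
        Nat.mul_le_mul_right _ ((card_le_card hsub).trans card_biUnion_le)
    _ = ∑ i ∈ I with #(S i) = t, #{A ∈ s.powersetCard k | S i ⊆ A} * #s ^ t := sum_mul ..
    _ ≤ ∑ i ∈ I with #(S i) = t, (#s).choose k * k ^ t := by
        refine sum_le_sum fun i hi => ?_
        have := card_filter_subset_powersetCard_mul_pow_le s (S i) hk
        rwa [(mem_filter.1 hi).2] at this
    _ ≤ _ := by
        rw [sum_const, smul_eq_mul]
        exact Nat.mul_le_mul_right _ (card_le_card (filter_subset _ _))

/-- The elements of `U` together with their reflections `m - a`. -/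
def reflectUnion (m : ℤ) (U : Finset ℤ) : Finset ℤ := U ∪ U.image (m - ·)

theorem card_reflectUnion {m : ℤ} {U : Finset ℤ} (hU : ∀ a ∈ U, 2 * a < m) :
    #(reflectUnion m U) = 2 * #U := by
  rw [reflectUnion, card_union_of_disjoint, card_image_of_injective _ sub_right_injective, two_mul]
  rw [disjoint_left]
  intro x hx hx'
  obtain ⟨y, hy, rfl⟩ := mem_image.1 hx'
  have := hU _ hx
  have := hU _ hy
  omega

theorem notMem_reflectUnion {a : ℤ} {U : Finset ℤ} (hU : ∀ x ∈ U, 2 * x < 2 * a) :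
    a ∉ reflectUnion (2 * a) U := by
  intro h
  rcases mem_union.1 h with h | h
  · exact lt_irrefl _ (hU _ h)
  · obtain ⟨y, hy, h⟩ := mem_image.1 h
    have := hU _ hy
    omega

theorem reflectUnion_subset {m : ℤ} {U A : Finset ℤ} (hU : ∀ a ∈ U, a ∈ A ∧ m - a ∈ A) :
    reflectUnion m U ⊆ A :=
  union_subset (fun a ha => (hU a ha).1) (image_subset_iff.2 fun a ha => (hU a ha).2)

theorem repFn_two_le (A : Finset ℤ) (m : ℤ) :
    repFn ↑A 2 m ≤ (#{a ∈ A | m - a ∈ A ∧ 2 * a ≤ m} : ℕ∞) := by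
  rw [repFn, ← Set.encard_coe_eq_coe_finsetCard]
  refine Set.encard_le_encard_of_injOn (f := fun f => f 0) ?_ ?_
  · rintro f ⟨hA, hmono, hsum⟩
    have h01 : f 0 ≤ f 1 := hmono (by decide)
    rw [Fin.sum_univ_two] at hsum
    have h1 : m - f 0 = f 1 := by omega
    simp only [coe_filter, Set.mem_ofPred_eq, h1]
    exact ⟨hA 0, hA 1, by omega⟩
  · rintro f ⟨-, -, hf⟩ f' ⟨-, -, hf'⟩ h
    rw [Fin.sum_univ_two] at hf hf'
    simp only at h
    funext i
    fin_cases i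
    · exact h
    · change f 1 = f' 1
      omega

/-- A finite set which is not a `B_2[g]`-set contains `2g + 2` elements forming `g + 1` pairs with
a common sum, or `2g + 1` elements forming `g` pairs symmetric about the remaining element. -/
theorem exists_reflectUnion_subset_of_not_isBhg {A : Finset ℤ} {g : ℕ} (hA : ¬ IsBhg ↑A 2 g) :
    (∃ m U, U ⊆ A ∧ #U = g + 1 ∧ (∃ x ∈ A, ∃ y ∈ A, x + y = m) ∧
        #(reflectUnion m U) = 2 * g + 2 ∧ reflectUnion m U ⊆ A) ∨
      ∃ a ∈ A, ∃ U ⊆ A, #U = g ∧ #(insert a (reflectUnion (2 * a) U)) = 2 * g + 1 ∧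
        insert a (reflectUnion (2 * a) U) ⊆ A := by
  simp only [IsBhg, not_forall, not_le] at hA
  obtain ⟨m, hm⟩ := hA
  have hcard : g < #{a ∈ A | m - a ∈ A ∧ 2 * a ≤ m} := by
    exact_mod_cast hm.trans_le (repFn_two_le A m)
  set R := {a ∈ A | m - a ∈ A ∧ 2 * a ≤ m} with hR
  have hRmem : ∀ x ∈ R, x ∈ A ∧ m - x ∈ A ∧ 2 * x ≤ m := fun x hx => mem_filter.1 hx
  by_cases h : ∃ a ∈ R, 2 * a = m
  · obtain ⟨a, ha, rfl⟩ := h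
    have hg : g ≤ #(R.erase a) := by rw [card_erase_of_mem ha]; omega
    obtain ⟨U, hU, hUg⟩ := exists_subset_card_eq hg
    have hlt : ∀ x ∈ U, 2 * x < 2 * a := fun x hx => by
      have h1 := mem_erase.1 (hU hx)
      have h2 := (hRmem x h1.2).2.2
      have h3 := h1.1
      omega
    have hUR : ∀ x ∈ U, x ∈ R := fun x hx => mem_of_mem_erase (hU hx)
    refine Or.inr ⟨a, (hRmem a ha).1, U, fun x hx => (hRmem x (hUR x hx)).1, hUg, ?_, ?_⟩
    · rw [card_insert_of_notMem (notMem_reflectUnion hlt), card_reflectUnion hlt, hUg]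
    · refine insert_subset (hRmem a ha).1 (reflectUnion_subset fun x hx => ?_)
      exact ⟨(hRmem x (hUR x hx)).1, (hRmem x (hUR x hx)).2.1⟩
  · push Not at h
    obtain ⟨U, hU, hUg⟩ := exists_subset_card_eq (Nat.succ_le_of_lt hcard)
    obtain ⟨x, hx⟩ : U.Nonempty := card_pos.1 (by omega)
    refine Or.inl ⟨m, U, fun x hx => (hRmem x (hU hx)).1, hUg,
      ⟨x, (hRmem x (hU hx)).1, m - x, (hRmem x (hU hx)).2.1, by ring⟩, ?_, ?_⟩
    · rw [card_reflectUnion fun x hx => lt_of_le_of_ne (hRmem x (hU hx)).2.2 (h x (hU hx)), hUg]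
      omega
    · exact reflectUnion_subset fun x hx => ⟨(hRmem x (hU hx)).1, (hRmem x (hU hx)).2.1⟩

open Classical in
theorem card_not_isBhg_mul_pow_le (g : ℕ) {k n : ℕ} (hk : 1 ≤ k) (hkn : k ≤ n) :
    #({A ∈ (Icc (1 : ℤ) n).powersetCard k | ¬ IsBhg (A : Set ℤ) 2 g} : Finset (Finset ℤ)) * n ^ g
      ≤ 3 * n.choose k * k ^ (2 * g + 2) := by
  set s := Icc (1 : ℤ) n with hs
  have hsn : #s = n := by simp [hs]
  have hks : k ≤ #s := by omega
  have hb₁ := card_filter_exists_subset_mul_pow_le s hks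
    (Icc (1 : ℤ) (2 * n : ℕ) ×ˢ s.powersetCard (g + 1))
    (fun p => reflectUnion p.1 p.2) (2 * g + 2)
  have hb₂ := card_filter_exists_subset_mul_pow_le s hks (s ×ˢ s.powersetCard g)
    (fun p => insert p.1 (reflectUnion (2 * p.1) p.2)) (2 * g + 1)
  set F₁ := {A ∈ s.powersetCard k | ∃ p ∈ Icc (1 : ℤ) (2 * n : ℕ) ×ˢ s.powersetCard (g + 1),
    #(reflectUnion p.1 p.2) = 2 * g + 2 ∧ reflectUnion p.1 p.2 ⊆ A}
  set F₂ := {A ∈ s.powersetCard k | ∃ p ∈ s ×ˢ s.powersetCard g,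
    #(insert p.1 (reflectUnion (2 * p.1) p.2)) = 2 * g + 1 ∧
      insert p.1 (reflectUnion (2 * p.1) p.2) ⊆ A}
  have hsub : ({A ∈ s.powersetCard k | ¬ IsBhg (A : Set ℤ) 2 g} : Finset (Finset ℤ)) ⊆
      F₁ ∪ F₂ := by
    intro A hA
    obtain ⟨hAk, hA⟩ := mem_filter.1 hA
    have hAs := (mem_powersetCard.1 hAk).1
    rcases exists_reflectUnion_subset_of_not_isBhg hA with
      ⟨m, U, hUA, hUg, ⟨x, hx, y, hy, hxy⟩, hc, hS⟩ | ⟨a, ha, U, hUA, hUg, hc, hS⟩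
    · refine mem_union_left _ (mem_filter.2 ⟨hAk, (m, U), mem_product.2 ⟨?_, ?_⟩, hc, hS⟩)
      · have h1 := mem_Icc.1 (hAs hx)
        have h2 := mem_Icc.1 (hAs hy)
        refine mem_Icc.2 ⟨?_, ?_⟩ <;> push_cast <;> omega
      · exact mem_powersetCard.2 ⟨hUA.trans hAs, hUg⟩
    · exact mem_union_right _ (mem_filter.2 ⟨hAk, (a, U), mem_product.2
        ⟨hAs ha, mem_powersetCard.2 ⟨hUA.trans hAs, hUg⟩⟩, hc, hS⟩)
  have hcard := (card_le_card hsub).trans (card_union_le _ _)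
  simp only [card_product, card_powersetCard, hsn, Int.card_Icc, add_sub_cancel_right,
    Int.toNat_natCast] at hb₁ hb₂
  have hn : 0 < n := by omega
  refine Nat.le_of_mul_le_mul_right ?_ (pow_pos hn (g + 2))
  calc _ = #({A ∈ s.powersetCard k | ¬ IsBhg (A : Set ℤ) 2 g} : Finset (Finset ℤ)) *
        n ^ (2 * g + 2) := by ring
    _ ≤ (#F₁ + #F₂) * n ^ (2 * g + 2) := by gcongr
    _ = #F₁ * n ^ (2 * g + 2) + #F₂ * n ^ (2 * g + 1) * n := by ring
    _ ≤ 2 * n * n.choose (g + 1) * (n.choose k * k ^ (2 * g + 2)) +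
        n * n.choose g * (n.choose k * k ^ (2 * g + 1)) * n := by gcongr
    _ ≤ 2 * n * n ^ (g + 1) * (n.choose k * k ^ (2 * g + 2)) +
        n * n ^ g * (n.choose k * k ^ (2 * g + 2)) * n := by
      gcongr
      · exact Nat.choose_le_pow n (g + 1)
      · exact Nat.choose_le_pow n g
      · norm_num
    _ = _ := by ring

open Classical in
theorem countBhg_add_card_not_isBhg (h g k n : ℕ) :
    countBhg h g k n +
      #({A ∈ (Icc (1 : ℤ) n).powersetCard k | ¬ IsBhg (A : Set ℤ) h g} : Finset (Finset ℤ)) =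
    n.choose k := by
  have hset : {A : Finset ℤ | ↑A ⊆ Set.Icc (1 : ℤ) (n : ℤ) ∧ #A = k ∧ IsBhg ↑A h g} =
      ({A ∈ (Icc (1 : ℤ) n).powersetCard k | IsBhg (A : Set ℤ) h g} : Finset (Finset ℤ)) := by
    ext A
    simp [mem_powersetCard, ← coe_subset, and_assoc]
  rw [countBhg, hset, Set.ncard_coe_finset, card_filter_add_card_filter_not, card_powersetCard]
  simp

theorem one_sub_le_countBhg_div_choose (g : ℕ) {k n : ℕ} (hk : 1 ≤ k) (hkn : k ≤ n) :
    1 - 3 * ((k : ℝ) / (n : ℝ) ^ ((g : ℝ) / (2 * g + 2))) ^ (2 * g + 2)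
      ≤ (countBhg 2 g k n : ℝ) / (n.choose k : ℝ) := by
  classical
  have hn : (0 : ℝ) < n := by exact_mod_cast (by omega : 0 < n)
  have hC : (0 : ℝ) < n.choose k := by exact_mod_cast Nat.choose_pos hkn
  have hpow : ((n : ℝ) ^ ((g : ℝ) / (2 * g + 2))) ^ (2 * g + 2) = (n : ℝ) ^ g := by
    rw [← Real.rpow_natCast, ← Real.rpow_mul hn.le, ← Real.rpow_natCast]
    congr 1
    push_cast
    field_simp
  have hbad := card_not_isBhg_mul_pow_le g hk hkn
  have hadd := countBhg_add_card_not_isBhg 2 g k n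
  set b := #({A ∈ (Icc (1 : ℤ) n).powersetCard k | ¬ IsBhg (A : Set ℤ) 2 g} : Finset (Finset ℤ))
  have hbad' : (b : ℝ) * n ^ g ≤ 3 * n.choose k * k ^ (2 * g + 2) := by exact_mod_cast hbad
  have hadd' : (countBhg 2 g k n : ℝ) + b = n.choose k := by exact_mod_cast hadd
  rw [div_pow, hpow, le_div_iff₀ hC]
  have : (b : ℝ) ≤ 3 * n.choose k * k ^ (2 * g + 2) / n ^ g := by
    rwa [le_div_iff₀ (by positivity)]
  calc _ = (n.choose k : ℝ) - 3 * n.choose k * k ^ (2 * g + 2) / n ^ g := by ring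
    _ ≤ _ := by linarith

end

open Filter Topology in
/-- If `(k_n)` is a sequence of positive integers with `k_n ≤ n` and
`k_n = o(n^{g/(2g+2)})`, then `B_2[g](k_n, n) / C(n, k_n) → 1`. -/
theorem countB2g_div_choose_tendsto_one (g : ℕ) (hg : 1 ≤ g) (k : ℕ → ℕ)
    (hk : ∀ n : ℕ, 1 ≤ n → 1 ≤ k n ∧ k n ≤ n)
    (hko : Tendsto (fun n : ℕ => (k n : ℝ) / (n : ℝ) ^ ((g : ℝ) / (2 * g + 2)))
      atTop (𝓝 0)) :
    Tendsto (fun n : ℕ => (countBhg 2 g (k n) n : ℝ) / (n.choose (k n) : ℝ))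
      atTop (𝓝 1) := by
  have hlim : Tendsto (fun n : ℕ => 1 - 3 * ((k n : ℝ) /
      (n : ℝ) ^ ((g : ℝ) / (2 * g + 2))) ^ (2 * g + 2)) atTop (𝓝 1) := by
    simpa using ((hko.pow (2 * g + 2)).const_mul 3).const_sub 1
  refine tendsto_of_tendsto_of_tendsto_of_le_of_le' hlim tendsto_const_nhds ?_ ?_
  · filter_upwards [eventually_ge_atTop 1] with n hn
    exact one_sub_le_countBhg_div_choose g (hk n hn).1 (hk n hn).2
  · refine Eventually.of_forall fun n => div_le_one_of_le₀ ?_ (Nat.cast_nonneg _)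
    exact_mod_cast (Nat.le_add_right _ _).trans_eq (countBhg_add_card_not_isBhg 2 g (k n) n)
end

section
/- Let (k_n) be a sequence of positive integers with k_n ≤ n for all n and k_n = o(n^{1/4}), i.e., lim_{n→∞} k_n / n^{1/4} = 0. Then lim_{n→∞} B_2(k_n, n) / C(n, k_n) = 1, where B_2(k,n) denotes the number of Sidon sets of cardinality k contained in {1,2,...,n}. -/
/-- `countSidon k n` is the number of Sidon sets (sets in which every integer has at
most one representation as a nondecreasing sum of two elements) of cardinality `k`
contained in `{1, 2, …, n}`. -/
noncomputable def countSidon (k n : ℕ) : ℕ :=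
  Set.ncard {A : Finset ℤ | ↑A ⊆ Set.Icc (1 : ℤ) (n : ℤ) ∧ A.card = k ∧
    ∀ m : ℤ, repFn ↑A 2 m ≤ 1}

/-- Every integer has at most one representation as an unordered sum of two elements of `A`. -/
def IsSidonFinset (A : Finset ℤ) : Prop :=
  ∀ a ∈ A, ∀ b ∈ A, ∀ c ∈ A, ∀ d ∈ A, a + b = c + d → (a = c ∧ b = d) ∨ (a = d ∧ b = c)

theorem IsSidonFinset.repFn_le_one {A : Finset ℤ} (hA : IsSidonFinset A) (m : ℤ) :
    repFn (A : Set ℤ) 2 m ≤ 1 := by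
  rw [repFn, Set.encard_le_one_iff]
  rintro f g ⟨hf, hfm, hfs⟩ ⟨hg, hgm, hgs⟩
  have hf01 : f 0 ≤ f 1 := hfm (by decide)
  have hg01 : g 0 ≤ g 1 := hgm (by decide)
  rw [Fin.sum_univ_two] at hfs hgs
  have h := hA _ (hf 0) _ (hf 1) _ (hg 0) _ (hg 1) (hfs.trans hgs.symm)
  ext i
  fin_cases i <;> simp <;> omega

/-- The integers whose insertion into `A` could destroy the Sidon property. -/
def sidonObstructions (A : Finset ℤ) : Finset ℤ :=
  (A ×ˢ A ×ˢ A).image (fun p => p.1 + p.2.1 - p.2.2) ∪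
    (A ×ˢ A).image (fun p => (p.1 + p.2) / 2)

theorem card_sidonObstructions_le (A : Finset ℤ) :
    (sidonObstructions A).card ≤ 2 * A.card ^ 3 := by
  have h1 : ((A ×ˢ A ×ˢ A).image (fun p => p.1 + p.2.1 - p.2.2)).card ≤ A.card ^ 3 :=
    Finset.card_image_le.trans_eq (by simp only [Finset.card_product]; ring)
  have h2 : ((A ×ˢ A).image (fun p => (p.1 + p.2) / 2)).card ≤ A.card ^ 2 :=
    Finset.card_image_le.trans_eq (by simp only [Finset.card_product]; ring)
  have h3 : A.card ^ 2 ≤ A.card ^ 3 := by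
    rcases Nat.eq_zero_or_pos A.card with h | h
    · simp [h]
    · exact Nat.pow_le_pow_right h (by norm_num)
  exact (Finset.card_union_le _ _).trans (by omega)

theorem add_sub_mem_sidonObstructions {A : Finset ℤ} {a b c : ℤ} (ha : a ∈ A) (hb : b ∈ A)
    (hc : c ∈ A) : a + b - c ∈ sidonObstructions A :=
  Finset.mem_union_left _ (Finset.mem_image.2 ⟨(a, b, c), by simp [ha, hb, hc], rfl⟩)

theorem subset_sidonObstructions (A : Finset ℤ) : A ⊆ sidonObstructions A := fun a ha => by
  simpa using add_sub_mem_sidonObstructions ha ha ha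

theorem IsSidonFinset.insert {A : Finset ℤ} (hA : IsSidonFinset A) {x : ℤ}
    (hx : x ∉ sidonObstructions A) : IsSidonFinset (insert x A) := by
  have h1 : ∀ a ∈ A, ∀ b ∈ A, ∀ c ∈ A, x + c ≠ a + b := fun a ha b hb c hc h =>
    hx (by rw [eq_sub_of_add_eq h]; exact add_sub_mem_sidonObstructions ha hb hc)
  have h2 : ∀ a ∈ A, ∀ b ∈ A, x + x ≠ a + b := fun a ha b hb h =>
    hx (Finset.mem_union_right _ (Finset.mem_image.2 ⟨(a, b), by simp [ha, hb], by
      simp only; omega⟩))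
  intro a ha b hb c hc d hd h
  rw [Finset.mem_insert] at ha hb hc hd
  rcases ha with rfl | ha <;> rcases hb with rfl | hb <;> rcases hc with rfl | hc <;>
    rcases hd with rfl | hd <;> grind [IsSidonFinset]

open Classical in
/-- The Sidon subsets of `{1, …, n}` of cardinality `k`. -/
noncomputable def sidonFamily (k n : ℕ) : Finset (Finset ℤ) :=
  ((Finset.Icc (1 : ℤ) n).powersetCard k).filter IsSidonFinset

theorem mem_sidonFamily {k n : ℕ} {A : Finset ℤ} :
    A ∈ sidonFamily k n ↔ (A ⊆ Finset.Icc (1 : ℤ) n ∧ A.card = k) ∧ IsSidonFinset A := by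
  simp [sidonFamily, Finset.mem_powersetCard]

theorem card_sidonFamily_mul_le (j n : ℕ) :
    (sidonFamily j n).card * (n - 2 * j ^ 3) ≤ (sidonFamily (j + 1) n).card * (j + 1) := by
  classical
  refine Finset.card_mul_le_card_mul (fun S T => S ⊆ T) (fun S hS => ?_) (fun T hT => ?_)
  · obtain ⟨⟨hSn, hSj⟩, hS⟩ := mem_sidonFamily.1 hS
    have hnot : ∀ x ∈ Finset.Icc (1 : ℤ) n \ sidonObstructions S, x ∉ S := fun x hx hxS =>
      (Finset.mem_sdiff.1 hx).2 (subset_sidonObstructions S hxS)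
    calc n - 2 * j ^ 3 ≤ (Finset.Icc (1 : ℤ) n).card - (sidonObstructions S).card := by
          have := card_sidonObstructions_le S
          rw [hSj] at this
          simp only [Int.card_Icc]
          omega
      _ ≤ (Finset.Icc (1 : ℤ) n \ sidonObstructions S).card := Finset.le_card_sdiff _ _
      _ ≤ _ := by
          refine Finset.card_le_card_of_injOn (fun x => insert x S) (fun x hx => ?_) ?_
          · have hx' := Finset.mem_sdiff.1 hx
            rw [Finset.mem_coe, Finset.mem_bipartiteAbove, mem_sidonFamily]
            exact ⟨⟨⟨Finset.insert_subset hx'.1 hSn,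
              by rw [Finset.card_insert_of_notMem (hnot x hx), hSj]⟩, hS.insert hx'.2⟩,
              Finset.subset_insert x S⟩
          · intro x hx y hy hxy
            have : x ∈ insert y S := by
              rw [← show insert x S = insert y S from hxy]
              exact Finset.mem_insert_self x S
            exact (Finset.mem_insert.1 this).resolve_right (hnot x hx)
  · calc _ ≤ (T.powersetCard j).card := by
          refine Finset.card_le_card fun S hS => ?_
          rw [Finset.mem_bipartiteBelow, mem_sidonFamily] at hS
          exact Finset.mem_powersetCard.2 ⟨hS.2, hS.1.1.2⟩
      _ = j + 1 := by
          rw [Finset.card_powersetCard, (mem_sidonFamily.1 hT).1.2, Nat.choose_succ_self_right]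

theorem sub_mul_choose_le_mul_card_sidonFamily (j n : ℕ) :
    ((n : ℝ) - 2 * (j : ℝ) ^ 4) * n.choose j ≤ n * (sidonFamily j n).card := by
  induction j with
  | zero =>
    have : (∅ : Finset ℤ) ∈ sidonFamily 0 n := mem_sidonFamily.2 (by simp [IsSidonFinset])
    have h1 : (1 : ℝ) ≤ (sidonFamily 0 n).card := by
      exact_mod_cast Finset.card_pos.2 ⟨_, this⟩
    simpa using le_mul_of_one_le_right (Nat.cast_nonneg (α := ℝ) n) h1
  | succ j ih =>
    rcases le_or_gt ((n : ℝ) - 2 * ((j + 1 : ℕ) : ℝ) ^ 4) 0 with h | h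
    · exact (mul_nonpos_of_nonpos_of_nonneg h (by positivity)).trans (by positivity)
    have hj : (0 : ℝ) ≤ j := j.cast_nonneg
    have hpow : (j : ℝ) ^ 3 + (j : ℝ) ^ 4 ≤ ((j + 1 : ℕ) : ℝ) ^ 4 := by
      push_cast
      nlinarith [pow_nonneg hj 2, pow_nonneg hj 3]
    have hn3 : 0 ≤ (n : ℝ) - 2 * (j : ℝ) ^ 3 := by linarith [pow_nonneg hj 4]
    have hstep : ((sidonFamily j n).card : ℝ) * ((n : ℝ) - 2 * (j : ℝ) ^ 3) ≤
        (sidonFamily (j + 1) n).card * ((j : ℝ) + 1) := by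
      have hn3' : 2 * j ^ 3 ≤ n := by
        have : 2 * (j : ℝ) ^ 3 ≤ n := by linarith
        exact_mod_cast this
      have := card_sidonFamily_mul_le j n
      rw [← Nat.cast_le (α := ℝ)] at this
      push_cast [Nat.cast_sub hn3'] at this
      exact this
    have hchoose : (n.choose (j + 1) : ℝ) * ((j : ℝ) + 1) ≤ n.choose j * n := by
      have : n.choose (j + 1) * (j + 1) ≤ n.choose j * n := by
        rw [Nat.choose_succ_right_eq]
        exact Nat.mul_le_mul_left _ (Nat.sub_le _ _)
      exact_mod_cast this
    have hquad : ((n : ℝ) - 2 * ((j + 1 : ℕ) : ℝ) ^ 4) * n ≤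
        ((n : ℝ) - 2 * (j : ℝ) ^ 3) * ((n : ℝ) - 2 * (j : ℝ) ^ 4) := by
      have h7 : (0 : ℝ) ≤ (j : ℝ) ^ 3 * (j : ℝ) ^ 4 := by positivity
      nlinarith [mul_le_mul_of_nonneg_right hpow (Nat.cast_nonneg (α := ℝ) n)]
    refine le_of_mul_le_mul_right ?_ (by positivity : (0 : ℝ) < (j : ℝ) + 1)
    calc ((n : ℝ) - 2 * ((j + 1 : ℕ) : ℝ) ^ 4) * n.choose (j + 1) * ((j : ℝ) + 1)
        = ((n : ℝ) - 2 * ((j + 1 : ℕ) : ℝ) ^ 4) * (n.choose (j + 1) * ((j : ℝ) + 1)) := by ring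
      _ ≤ ((n : ℝ) - 2 * ((j + 1 : ℕ) : ℝ) ^ 4) * (n.choose j * n) :=
          mul_le_mul_of_nonneg_left hchoose h.le
      _ = ((n : ℝ) - 2 * ((j + 1 : ℕ) : ℝ) ^ 4) * n * n.choose j := by ring
      _ ≤ ((n : ℝ) - 2 * (j : ℝ) ^ 3) * ((n : ℝ) - 2 * (j : ℝ) ^ 4) * n.choose j :=
          mul_le_mul_of_nonneg_right hquad (by positivity)
      _ = ((n : ℝ) - 2 * (j : ℝ) ^ 3) * (((n : ℝ) - 2 * (j : ℝ) ^ 4) * n.choose j) := by ring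
      _ ≤ ((n : ℝ) - 2 * (j : ℝ) ^ 3) * (n * (sidonFamily j n).card) :=
          mul_le_mul_of_nonneg_left ih hn3
      _ = n * ((sidonFamily j n).card * ((n : ℝ) - 2 * (j : ℝ) ^ 3)) := by ring
      _ ≤ n * ((sidonFamily (j + 1) n).card * ((j : ℝ) + 1)) :=
          mul_le_mul_of_nonneg_left hstep (by positivity)
      _ = n * (sidonFamily (j + 1) n).card * ((j : ℝ) + 1) := by ring

theorem setOf_sidon_subset_powersetCard (k n : ℕ) :
    {A : Finset ℤ | ↑A ⊆ Set.Icc (1 : ℤ) (n : ℤ) ∧ A.card = k ∧ ∀ m : ℤ, repFn ↑A 2 m ≤ 1} ⊆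
      ((Finset.Icc (1 : ℤ) n).powersetCard k : Set (Finset ℤ)) := by
  rintro A ⟨hA, hk, -⟩
  rw [← Finset.coe_Icc, Finset.coe_subset] at hA
  exact Finset.mem_coe.2 (Finset.mem_powersetCard.2 ⟨hA, hk⟩)

theorem countSidon_le_choose (k n : ℕ) : countSidon k n ≤ n.choose k := by
  refine (Set.ncard_le_ncard (setOf_sidon_subset_powersetCard k n)
    (Finset.finite_toSet _)).trans_eq ?_
  rw [Set.ncard_coe_finset, Finset.card_powersetCard, Int.card_Icc]
  simp

theorem card_sidonFamily_le_countSidon (k n : ℕ) :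
    (sidonFamily k n).card ≤ countSidon k n := by
  rw [← Set.ncard_coe_finset]
  refine Set.ncard_le_ncard (fun A hA => ?_)
    ((Finset.finite_toSet _).subset (setOf_sidon_subset_powersetCard k n))
  obtain ⟨⟨hAn, hAk⟩, hA⟩ := mem_sidonFamily.1 (Finset.mem_coe.1 hA)
  refine ⟨?_, hAk, hA.repFn_le_one⟩
  rwa [← Finset.coe_Icc, Finset.coe_subset]

open Filter Topology in
/-- If `(k_n)` is a sequence of positive integers with `k_n ≤ n` and
`k_n = o(n^{1/4})`, then `B_2(k_n, n) / C(n, k_n) → 1`. -/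
theorem countSidon_div_choose_tendsto_one (k : ℕ → ℕ)
    (hk : ∀ n : ℕ, 1 ≤ n → 1 ≤ k n ∧ k n ≤ n)
    (hko : Tendsto (fun n : ℕ => (k n : ℝ) / (n : ℝ) ^ ((1 : ℝ) / 4)) atTop (𝓝 0)) :
    Tendsto (fun n : ℕ => (countSidon (k n) n : ℝ) / (n.choose (k n) : ℝ))
      atTop (𝓝 1) := by
  have hlim : Tendsto (fun n : ℕ => 1 - 2 * ((k n : ℝ) / (n : ℝ) ^ ((1 : ℝ) / 4)) ^ 4)
      atTop (𝓝 1) := by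
    simpa using ((hko.pow 4).const_mul 2).const_sub 1
  refine tendsto_of_tendsto_of_tendsto_of_le_of_le' hlim tendsto_const_nhds ?_ ?_
  · filter_upwards [eventually_ge_atTop 1] with n hn
    have hn0 : (0 : ℝ) < n := by exact_mod_cast hn
    have hc : (0 : ℝ) < n.choose (k n) := by exact_mod_cast Nat.choose_pos (hk n hn).2
    have hroot : ((n : ℝ) ^ ((1 : ℝ) / 4)) ^ 4 = n := by
      rw [← Real.rpow_natCast, ← Real.rpow_mul hn0.le]
      norm_num
    rw [div_pow, hroot, le_div_iff₀ hc]
    have hcard : ((sidonFamily (k n) n).card : ℝ) ≤ countSidon (k n) n := by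
      exact_mod_cast card_sidonFamily_le_countSidon (k n) n
    refine le_of_mul_le_mul_left ?_ hn0
    calc (n : ℝ) * ((1 - 2 * ((k n : ℝ) ^ 4 / n)) * (n.choose (k n) : ℝ))
        = ((n : ℝ) - 2 * (k n : ℝ) ^ 4) * (n.choose (k n) : ℝ) := by field_simp
      _ ≤ (n : ℝ) * ((sidonFamily (k n) n).card : ℝ) := sub_mul_choose_le_mul_card_sidonFamily (k n) n
      _ ≤ (n : ℝ) * (countSidon (k n) n : ℝ) := mul_le_mul_of_nonneg_left hcard hn0.le
  · exact Eventually.of_forall fun n =>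
      div_le_one_of_le₀ (by exact_mod_cast countSidon_le_choose (k n) n) (Nat.cast_nonneg _)
end

section
/- Let g be a positive integer and let (k_n) be a sequence of positive integers with k_n ≤ n for all n and k_n = o(n^{g/(2g+3)}), i.e., lim_{n→∞} k_n / n^{g/(2g+3)} = 0. Then lim_{n→∞} (Σ_{k ≤ k_n} B_2[g](k, n)) / (Σ_{k ≤ k_n} C(n, k)) = 1. -/
/-- Iterating `k * C(n, k) = n * C(n - 1, k - 1)`. -/
theorem choose_sub_mul_pow_le {n k r : ℕ} (hr : r ≤ k) (hk : k ≤ n) :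
    (n - r).choose (k - r) * n ^ r ≤ n.choose k * k ^ r := by
  induction r with
  | zero => simp
  | succ r ih =>
    have ih := ih (by omega)
    obtain ⟨a, rfl⟩ : ∃ a, k = a + 1 + r := ⟨k - 1 - r, by omega⟩
    obtain ⟨b, rfl⟩ : ∃ b, n = b + 1 + r := ⟨n - 1 - r, by omega⟩
    rw [show b + 1 + r - (r + 1) = b by omega, show a + 1 + r - (r + 1) = a by omega]
    rw [show b + 1 + r - r = b + 1 by omega, show a + 1 + r - r = a + 1 by omega] at ih
    have h := Nat.add_one_mul_choose_eq b a
    have h2 : (a + 1) * (b + 1 + r) ≤ (a + 1 + r) * (b + 1) := by nlinarith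
    refine Nat.le_of_mul_le_mul_left ?_ (Nat.succ_pos b)
    calc (b + 1) * (b.choose a * (b + 1 + r) ^ (r + 1))
        = ((b + 1) * b.choose a) * (b + 1 + r) * (b + 1 + r) ^ r := by ring
      _ = (b + 1).choose (a + 1) * ((a + 1) * (b + 1 + r)) * (b + 1 + r) ^ r := by
          rw [h]; ring
      _ ≤ (b + 1).choose (a + 1) * ((a + 1 + r) * (b + 1)) * (b + 1 + r) ^ r := by gcongr
      _ = (b + 1) * (a + 1 + r) * ((b + 1).choose (a + 1) * (b + 1 + r) ^ r) := by ring
      _ ≤ (b + 1) * (a + 1 + r) * ((b + 1 + r).choose (a + 1 + r) * (a + 1 + r) ^ r) := by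
          gcongr
      _ = (b + 1) * ((b + 1 + r).choose (a + 1 + r) * (a + 1 + r) ^ (r + 1)) := by ring

theorem card_powersetCard_filter_superset_mul_pow_le {α : Type*} [DecidableEq α]
    (U S : Finset α) (j : ℕ) :
    ((U.powersetCard j).filter (S ⊆ ·)).card * U.card ^ S.card ≤
      U.card.choose j * j ^ S.card := by
  rcases ((U.powersetCard j).filter (S ⊆ ·)).eq_empty_or_nonempty with h | ⟨A, hA⟩
  · simp [h]
  · rw [Finset.mem_filter, Finset.mem_powersetCard] at hA
    obtain ⟨⟨hAU, hAj⟩, hSA⟩ := hA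
    have h1 : S.card ≤ j := hAj ▸ Finset.card_le_card hSA
    have h2 : j ≤ U.card := hAj ▸ Finset.card_le_card hAU
    refine le_trans (Nat.mul_le_mul_right _ ?_) (choose_sub_mul_pow_le h1 h2)
    rw [← Finset.card_sdiff_of_subset (hSA.trans hAU), ← Finset.card_powersetCard]
    refine Finset.card_le_card_of_injOn (· \ S) ?_ ?_
    · intro B hB
      simp only [Finset.coe_filter, Finset.mem_powersetCard, Set.mem_ofPred_eq] at hB
      simp only [Finset.mem_coe, Finset.mem_powersetCard]
      exact ⟨Finset.sdiff_subset_sdiff hB.1.1 le_rfl, by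
        rw [Finset.card_sdiff_of_subset hB.2, hB.1.2]⟩
    · intro B hB C hC hBC
      simp only [Finset.coe_filter, Set.mem_ofPred_eq] at hB hC
      rw [← Finset.sdiff_union_of_subset hB.2, ← Finset.sdiff_union_of_subset hC.2]
      exact congrArg (· ∪ S) hBC

/-- Union bound: few `j`-subsets of `U` contain a member of a family of `r`-sets. -/
theorem card_powersetCard_filter_exists_superset_mul_pow_le {α : Type*} [DecidableEq α]
    (U : Finset α) (F : Finset (Finset α)) (j r : ℕ) (hF : ∀ S ∈ F, S.card = r) :
    ((U.powersetCard j).filter (fun A => ∃ S ∈ F, S ⊆ A)).card * U.card ^ r ≤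
      F.card * (U.card.choose j * j ^ r) := by
  have h : (U.powersetCard j).filter (fun A => ∃ S ∈ F, S ⊆ A) ⊆
      F.biUnion fun S => (U.powersetCard j).filter (S ⊆ ·) := by
    intro A hA
    simp only [Finset.mem_filter, Finset.mem_biUnion] at hA ⊢
    obtain ⟨hA, S, hS, hSA⟩ := hA
    exact ⟨S, hS, hA, hSA⟩
  calc _ ≤ (∑ S ∈ F, ((U.powersetCard j).filter (S ⊆ ·)).card) * U.card ^ r := by
        gcongr
        exact (Finset.card_le_card h).trans Finset.card_biUnion_le
    _ = ∑ S ∈ F, ((U.powersetCard j).filter (S ⊆ ·)).card * U.card ^ r := Finset.sum_mul ..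
    _ ≤ ∑ _S ∈ F, U.card.choose j * j ^ r := by
        refine Finset.sum_le_sum fun S hS => ?_
        rw [← hF S hS]
        exact card_powersetCard_filter_superset_mul_pow_le U S j
    _ = _ := by simp

/-- The sets consisting of `g + 1` pairs of distinct elements with a common sum in `[1, 2n]`. -/
noncomputable def properPairSets (g n : ℕ) : Finset (Finset ℤ) :=
  ((Finset.Icc (1 : ℤ) (2 * n) ×ˢ (Finset.Icc (1 : ℤ) n).powersetCard (g + 1)).image
    fun p => p.2 ∪ p.2.image (p.1 - ·)).filter (·.card = 2 * g + 2)

/-- The sets consisting of a point of `[1, n]` and `g` pairs symmetric about it. -/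
noncomputable def centeredPairSets (g n : ℕ) : Finset (Finset ℤ) :=
  ((Finset.Icc (1 : ℤ) n ×ˢ (Finset.Icc (1 : ℤ) n).powersetCard g).image
    fun p => insert p.1 (p.2 ∪ p.2.image (2 * p.1 - ·))).filter (·.card = 2 * g + 1)

theorem card_properPairSets_le (g n : ℕ) : (properPairSets g n).card ≤ 2 * n ^ (g + 2) := by
  refine (Finset.card_filter_le _ _).trans (Finset.card_image_le.trans ?_)
  rw [Finset.card_product, Finset.card_powersetCard, Int.card_Icc, Int.card_Icc,
    show ((2 * n + 1 - 1 : ℤ)).toNat = 2 * n by omega, show ((n + 1 - 1 : ℤ)).toNat = n by omega]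
  calc 2 * n * n.choose (g + 1) ≤ 2 * n * n ^ (g + 1) := by
        gcongr; exact Nat.choose_le_pow _ _
    _ = _ := by ring

theorem card_centeredPairSets_le (g n : ℕ) : (centeredPairSets g n).card ≤ n ^ (g + 1) := by
  refine (Finset.card_filter_le _ _).trans (Finset.card_image_le.trans ?_)
  rw [Finset.card_product, Finset.card_powersetCard, Int.card_Icc,
    show ((n + 1 - 1 : ℤ)).toNat = n by omega]
  calc n * n.choose g ≤ n * n ^ g := by
        gcongr; exact Nat.choose_le_pow _ _
    _ = _ := by ring

/-- If `A` is not a `B_2[g]`-set, some sum has `g + 1` representations in `A`. -/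
theorem exists_card_eq_of_not_isBhg_two {A : Set ℤ} {g : ℕ} (h : ¬ IsBhg A 2 g) :
    ∃ (m : ℤ) (T : Finset ℤ), T.card = g + 1 ∧ ∀ a ∈ T, a ∈ A ∧ m - a ∈ A ∧ a ≤ m - a := by
  simp only [IsBhg, not_forall, not_le] at h
  obtain ⟨m, hm⟩ := h
  obtain ⟨t, ht, htc⟩ := Set.exists_subset_encard_eq (Order.add_one_le_of_lt hm)
  have hfin : t.Finite := Set.finite_of_encard_eq_coe (k := g + 1) (by simpa using htc)
  have hcard : hfin.toFinset.card = g + 1 := by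
    rw [hfin.encard_eq_coe_toFinset_card] at htc
    exact_mod_cast htc
  refine ⟨m, hfin.toFinset.image (· 0), ?_, ?_⟩
  · rw [Finset.card_image_of_injOn, hcard]
    intro f hf f' hf' hff
    have h1 := (ht (by simpa using hf)).2.2
    have h2 := (ht (by simpa using hf')).2.2
    rw [Fin.sum_univ_two] at h1 h2
    have hff : f 0 = f' 0 := hff
    funext i
    fin_cases i
    · exact hff
    · change f 1 = f' 1
      omega
  · intro a ha
    simp only [Finset.mem_image, Set.Finite.mem_toFinset] at ha
    obtain ⟨f, hf, rfl⟩ := ha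
    obtain ⟨h1, h2, h3⟩ := ht hf
    rw [Fin.sum_univ_two] at h3
    have h4 : m - f 0 = f 1 := by omega
    rw [h4]
    exact ⟨h1 0, h1 1, h2 (by decide)⟩

theorem exists_subset_of_not_isBhg_two {A : Finset ℤ} {g n : ℕ}
    (hA : A ⊆ Finset.Icc (1 : ℤ) n) (h : ¬ IsBhg (A : Set ℤ) 2 g) :
    (∃ S ∈ properPairSets g n, S ⊆ A) ∨ ∃ S ∈ centeredPairSets g n, S ⊆ A := by
  obtain ⟨m, T, hT, hTA⟩ := exists_card_eq_of_not_isBhg_two h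
  simp only [Finset.mem_coe] at hTA
  have hsub : T ⊆ A := fun a ha => (hTA a ha).1
  by_cases hx : ∃ x ∈ T, m = 2 * x
  · obtain ⟨x, hxT, rfl⟩ := hx
    have hlt : ∀ a ∈ T.erase x, a < x := fun a ha => by
      have h1 := Finset.ne_of_mem_erase ha
      have h2 := (hTA a (Finset.mem_of_mem_erase ha)).2.2
      omega
    refine Or.inr ⟨insert x (T.erase x ∪ (T.erase x).image (2 * x - ·)), ?_, ?_⟩
    · rw [centeredPairSets, Finset.mem_filter]
      refine ⟨Finset.mem_image.2 ⟨(x, T.erase x), ?_, rfl⟩, ?_⟩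
      · rw [Finset.mem_product, Finset.mem_powersetCard]
        refine ⟨hA (hsub hxT), ((Finset.erase_subset _ _).trans hsub).trans hA, ?_⟩
        rw [Finset.card_erase_of_mem hxT, hT, Nat.add_sub_cancel]
      · rw [Finset.card_insert_of_notMem, Finset.card_union_of_disjoint,
          Finset.card_image_of_injective _ sub_right_injective,
          Finset.card_erase_of_mem hxT, hT]
        · omega
        · rw [Finset.disjoint_left]
          intro a ha hb
          obtain ⟨b, hbT, rfl⟩ := Finset.mem_image.1 hb
          have := hlt _ ha
          have := hlt _ hbT
          omega
        · intro hmem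
          rcases Finset.mem_union.1 hmem with ha | hb
          · exact absurd (hlt _ ha) (lt_irrefl _)
          · obtain ⟨b, hb, hbx⟩ := Finset.mem_image.1 hb
            have := hlt _ hb
            omega
    · refine Finset.insert_subset (hsub hxT)
        (Finset.union_subset ((Finset.erase_subset _ _).trans hsub) ?_)
      exact Finset.image_subset_iff.2 fun a ha => (hTA a (Finset.mem_of_mem_erase ha)).2.1
  · push Not at hx
    refine Or.inl ⟨T ∪ T.image (m - ·), ?_, ?_⟩
    · rw [properPairSets, Finset.mem_filter]
      refine ⟨Finset.mem_image.2 ⟨(m, T), ?_, rfl⟩, ?_⟩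
      · rw [Finset.mem_product, Finset.mem_powersetCard]
        refine ⟨?_, hsub.trans hA, hT⟩
        obtain ⟨a, ha⟩ : T.Nonempty := Finset.card_pos.1 (by omega)
        have h1 := Finset.mem_Icc.1 (hA (hTA a ha).1)
        have h2 := Finset.mem_Icc.1 (hA (hTA a ha).2.1)
        rw [Finset.mem_Icc]
        dsimp only
        omega
      · rw [Finset.card_union_of_disjoint,
          Finset.card_image_of_injective _ sub_right_injective, hT]
        · omega
        · rw [Finset.disjoint_left]
          intro a ha hb
          obtain ⟨b, hbT, rfl⟩ := Finset.mem_image.1 hb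
          have := hx _ hbT
          have := (hTA _ ha).2.2
          have := (hTA _ hbT).2.2
          omega
    · exact Finset.union_subset hsub (Finset.image_subset_iff.2 fun a ha => (hTA a ha).2.1)

open Classical in
theorem countBhg_eq_card_filter (h g j n : ℕ) :
    countBhg h g j n =
      (((Finset.Icc (1 : ℤ) n).powersetCard j).filter
        (fun A : Finset ℤ => IsBhg (A : Set ℤ) h g)).card := by
  rw [countBhg, ← Set.ncard_coe_finset]
  congr 1
  ext A
  simp only [Set.mem_ofPred_eq, Finset.coe_filter, Finset.mem_powersetCard,
    ← Finset.coe_subset, Finset.coe_Icc, and_assoc]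

theorem countBhg_le_choose (h g j n : ℕ) : countBhg h g j n ≤ n.choose j := by
  classical
  rw [countBhg_eq_card_filter]
  refine (Finset.card_filter_le _ _).trans ?_
  simp

theorem choose_mul_pow_le_countBhg_two {g j n : ℕ} (hn : 1 ≤ n) :
    n.choose j * n ^ g ≤ countBhg 2 g j n * n ^ g + 3 * j ^ (2 * g + 2) * n.choose j := by
  classical
  set U := Finset.Icc (1 : ℤ) n with hU
  have hUc : U.card = n := by simp [hU]
  have hsplit := Finset.card_filter_add_card_filter_not (s := U.powersetCard j)
    (fun A : Finset ℤ => IsBhg (A : Set ℤ) 2 g)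
  rw [← countBhg_eq_card_filter, Finset.card_powersetCard, hUc] at hsplit
  have hbad : ((U.powersetCard j).filter (fun A : Finset ℤ => ¬ IsBhg (A : Set ℤ) 2 g)).card ≤
      ((U.powersetCard j).filter (fun A => ∃ S ∈ properPairSets g n, S ⊆ A)).card +
      ((U.powersetCard j).filter (fun A => ∃ S ∈ centeredPairSets g n, S ⊆ A)).card := by
    refine le_trans (Finset.card_le_card ?_) (Finset.card_union_le _ _)
    rw [← Finset.filter_or]
    intro A hA
    rw [Finset.mem_filter, Finset.mem_powersetCard] at hA
    rw [Finset.mem_filter, Finset.mem_powersetCard]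
    exact ⟨hA.1, exists_subset_of_not_isBhg_two hA.1.1 hA.2⟩
  have h1 := card_powersetCard_filter_exists_superset_mul_pow_le U (properPairSets g n) j
    (2 * g + 2) fun S hS => (Finset.mem_filter.1 hS).2
  have h2 := card_powersetCard_filter_exists_superset_mul_pow_le U (centeredPairSets g n) j
    (2 * g + 1) fun S hS => (Finset.mem_filter.1 hS).2
  rw [hUc] at h1 h2
  replace h1 := h1.trans (Nat.mul_le_mul_right _ (card_properPairSets_le g n))
  replace h2 := h2.trans (Nat.mul_le_mul_right _ (card_centeredPairSets_le g n))
  generalize ((U.powersetCard j).filter (fun A => ∃ S ∈ properPairSets g n, S ⊆ A)).card = p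
    at hbad h1
  generalize ((U.powersetCard j).filter (fun A => ∃ S ∈ centeredPairSets g n, S ⊆ A)).card = q
    at hbad h2
  have hp : p * n ^ g ≤ 2 * (n.choose j * j ^ (2 * g + 2)) := by
    refine Nat.le_of_mul_le_mul_left ?_ (pow_pos hn (g + 2))
    calc n ^ (g + 2) * (p * n ^ g) = p * n ^ (2 * g + 2) := by ring
      _ ≤ _ := h1
      _ = _ := by ring
  have hq : q * n ^ g ≤ n.choose j * j ^ (2 * g + 2) := by
    have hq1 : q * n ^ g ≤ n.choose j * j ^ (2 * g + 1) := by
      refine Nat.le_of_mul_le_mul_left ?_ (pow_pos hn (g + 1))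
      calc n ^ (g + 1) * (q * n ^ g) = q * n ^ (2 * g + 1) := by ring
        _ ≤ _ := h2
    refine hq1.trans (Nat.mul_le_mul_left _ ?_)
    rcases Nat.eq_zero_or_pos j with rfl | hj
    · simp
    · exact Nat.pow_le_pow_right hj (by omega)
  rw [← hsplit] at hp hq ⊢
  nlinarith [Nat.mul_le_mul_right (n ^ g) hbad]

open Filter Topology in
/-- If `(k_n)` is a sequence of positive integers with `k_n ≤ n` and
`k_n = o(n^{g/(2g+3)})`, then `(∑_{k ≤ k_n} B_2[g](k, n)) / (∑_{k ≤ k_n} C(n, k)) → 1`. -/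
theorem sum_countB2g_div_sum_choose_tendsto_one (g : ℕ) (hg : 1 ≤ g) (k : ℕ → ℕ)
    (hk : ∀ n : ℕ, 1 ≤ n → 1 ≤ k n ∧ k n ≤ n)
    (hko : Tendsto (fun n : ℕ => (k n : ℝ) / (n : ℝ) ^ ((g : ℝ) / (2 * g + 3)))
      atTop (𝓝 0)) :
    Tendsto (fun n : ℕ =>
        (∑ j ∈ Finset.range (k n + 1), (countBhg 2 g j n : ℝ)) /
          (∑ j ∈ Finset.range (k n + 1), (n.choose j : ℝ)))
      atTop (𝓝 1) := by
  have hε : Tendsto (fun n : ℕ =>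
      1 - 3 * ((k n : ℝ) / (n : ℝ) ^ ((g : ℝ) / (2 * g + 3))) ^ (2 * g + 3)) atTop (𝓝 1) := by
    simpa using ((hko.pow (2 * g + 3)).const_mul 3).const_sub 1
  have hpos : ∀ n : ℕ, 0 < ∑ j ∈ Finset.range (k n + 1), (n.choose j : ℝ) := fun n =>
    Finset.sum_pos' (fun _ _ => Nat.cast_nonneg _) ⟨0, by simp⟩
  refine tendsto_of_tendsto_of_tendsto_of_le_of_le' hε tendsto_const_nhds ?_ ?_
  · filter_upwards [eventually_ge_atTop 1] with n hn
    have hn0 : (0 : ℝ) < n := by exact_mod_cast hn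
    have hpow : ((n : ℝ) ^ ((g : ℝ) / (2 * g + 3))) ^ (2 * g + 3) = (n : ℝ) ^ g := by
      rw [← Real.rpow_natCast, ← Real.rpow_mul hn0.le, ← Real.rpow_natCast]
      congr 1
      push_cast
      field_simp
    rw [le_div_iff₀ (hpos n), Finset.mul_sum, div_pow, hpow]
    refine Finset.sum_le_sum fun j hj => ?_
    have hjk : j ≤ k n := Nat.lt_succ_iff.1 (Finset.mem_range.1 hj)
    have hjpow : j ^ (2 * g + 2) ≤ k n ^ (2 * g + 3) :=
      (Nat.pow_le_pow_left hjk _).trans (Nat.pow_le_pow_right (hk n hn).1 (by omega))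
    have h := (choose_mul_pow_le_countBhg_two (g := g) (j := j) hn).trans
      (Nat.add_le_add_left (Nat.mul_le_mul_right _ (Nat.mul_le_mul_left 3 hjpow)) _)
    have h' : (n.choose j : ℝ) * (n : ℝ) ^ g ≤ countBhg 2 g j n * (n : ℝ) ^ g +
        3 * (k n : ℝ) ^ (2 * g + 3) * n.choose j := by exact_mod_cast h
    have hng : (0 : ℝ) < (n : ℝ) ^ g := by positivity
    refine le_of_mul_le_mul_right ?_ hng
    calc (1 - 3 * ((k n : ℝ) ^ (2 * g + 3) / (n : ℝ) ^ g)) * n.choose j * (n : ℝ) ^ g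
        = n.choose j * (n : ℝ) ^ g - 3 * (k n : ℝ) ^ (2 * g + 3) * n.choose j := by
          field_simp
      _ ≤ _ := by linarith
  · refine Eventually.of_forall fun n => ?_
    rw [div_le_one (hpos n)]
    exact Finset.sum_le_sum fun j _ => by exact_mod_cast countBhg_le_choose 2 g j n
end

section
/- Let h ≥ 2. There exists a constant C > 0 depending only on h such that for all positive integers k ≤ n, one has C(n, k) - B_h(k, n) ≤ C · C(n, k) · k^{2h}/n; equivalently, B_h(k,n) ≥ C(n,k)·(1 - C·k^{2h}/n). -/
/-- `countBh h k n` is the number of `B_h`-sets of cardinality `k` contained in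
`{1, 2, …, n}`. -/
noncomputable def countBh (h k n : ℕ) : ℕ := countBhg h 1 k n

/-- Monotone tuples that take every value equally often are equal. -/
theorem Monotone.eq_of_card_fiber_eq {ι : Type*} [DecidableEq ι] {h : ℕ} {e : ι → ℤ}
    {u v : Fin h → ι} (hu : Monotone (e ∘ u)) (hv : Monotone (e ∘ v))
    (huv : ∀ j, (Finset.univ.filter fun i => u i = j).card =
      (Finset.univ.filter fun i => v i = j).card) :
    e ∘ u = e ∘ v := by
  obtain ⟨σ, rfl⟩ : ∃ σ : Fin h ≃ Fin h, u = v ∘ σ := by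
    have hfib : ∀ j, Nonempty ({i // u i = j} ≃ {i // v i = j}) := fun j =>
      Fintype.card_eq.1 (by simpa [Fintype.card_subtype] using huv j)
    exact ⟨Equiv.ofFiberEquiv fun j => (hfib j).some,
      funext fun i => (Equiv.ofFiberEquiv_map _ i).symm⟩
  exact Tuple.unique_monotone (f := e ∘ v) (σ := σ) (τ := Equiv.refl _) hu hv

/-- A nontrivial coincidence of sums at prescribed indices determines an embedding from its
values off a single index, so few embeddings satisfy it. -/
theorem card_embedding_sum_eq_le {ι κ : Type*} [Fintype ι] [DecidableEq ι] [Fintype κ]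
    (s : Finset ℤ) (u v : κ → ι) {j : ι}
    (hj : (Finset.univ.filter fun i => u i = j).card ≠
      (Finset.univ.filter fun i => v i = j).card) :
    (Finset.univ.filter fun e : ι ↪ s => ∑ i, (e (u i) : ℤ) = ∑ i, (e (v i) : ℤ)).card ≤
      s.card.descFactorial (Fintype.card ι - 1) := by
  have hcard : Fintype.card ({i : ι // i ≠ j} ↪ s) =
      s.card.descFactorial (Fintype.card ι - 1) := by
    simp [Fintype.card_embedding_eq, Fintype.card_subtype_compl]
  rw [← hcard, ← Finset.card_univ]
  refine Finset.card_le_card_of_injOn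
    (fun e => (Function.Embedding.subtype fun i => i ≠ j).trans e) (by simp) ?_
  intro e he e' he' hee'
  simp only [Finset.coe_filter, Finset.mem_univ, true_and, Set.mem_ofPred_eq] at he he'
  have hoff : ∀ i, i ≠ j → e i = e' i := fun i hi => DFunLike.congr_fun hee' ⟨i, hi⟩
  have hdiff : ∀ w : κ → ι, ∑ i, (e (w i) : ℤ) - ∑ i, (e' (w i) : ℤ) =
      (Finset.univ.filter fun i => w i = j).card * ((e j : ℤ) - e' j) := by
    intro w
    rw [← Finset.sum_sub_distrib, ← nsmul_eq_mul, ← Finset.sum_const, Finset.sum_filter]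
    refine Finset.sum_congr rfl fun i _ => ?_
    split_ifs with hi
    · rw [hi]
    · rw [hoff _ hi, sub_self]
  have hon : (e j : ℤ) = e' j := by
    have h1 := hdiff u
    rw [he, he', hdiff v] at h1
    by_contra hne
    exact hj (by exact_mod_cast (mul_right_cancel₀ (sub_ne_zero.2 hne) h1).symm)
  ext i
  by_cases hi : i = j
  · rw [hi, hon]
  · rw [hoff i hi]

/-- A set that is not a `B_h`-set has a nontrivial coincidence between sums at two tuples of
indices, for any enumeration of the set. -/
theorem exists_sum_eq_of_not_isBhg {ι : Type*} [DecidableEq ι] {h : ℕ} {A : Set ℤ}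
    (hA : ¬ IsBhg A h 1) {e : ι → ℤ} (he : A ⊆ Set.range e) :
    ∃ u v : Fin h → ι, (∃ j, (Finset.univ.filter fun i => u i = j).card ≠
      (Finset.univ.filter fun i => v i = j).card) ∧ ∑ i, e (u i) = ∑ i, e (v i) := by
  simp only [IsBhg, repFn, Nat.cast_one, Set.encard_le_one_iff, not_forall] at hA
  obtain ⟨m, f, g, ⟨hfA, hf, hfm⟩, ⟨hgA, hg, hgm⟩, hfg⟩ := hA
  choose u hu using fun i => he (hfA i)
  choose v hv using fun i => he (hgA i)
  obtain rfl : e ∘ u = f := funext hu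
  obtain rfl : e ∘ v = g := funext hv
  refine ⟨u, v, ?_, hfm.trans hgm.symm⟩
  by_contra! huv
  exact hfg (hf.eq_of_card_fiber_eq hg huv)

/-- A family of `k`-subsets of `s` is counted by the enumerations of its members. -/
theorem card_mul_factorial_le_card_embedding {k : ℕ} {s : Finset ℤ}
    {F : Finset (Finset ℤ)} (hF : F ⊆ s.powersetCard k) {E : Finset (Fin k ↪ s)}
    (hE : ∀ e : Fin k ↪ s, ∀ A ∈ F, Set.range (fun i => (e i : ℤ)) = A → e ∈ E) :
    F.card * k.factorial ≤ E.card := by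
  have hsub : ∀ A : F, (A : Finset ℤ) ⊆ s ∧ (A : Finset ℤ).card = k :=
    fun A => Finset.mem_powersetCard.1 (hF A.2)
  let enum : F × Equiv.Perm (Fin k) → (Fin k ↪ s) := fun p =>
    ⟨fun i => ⟨p.1.1.orderEmbOfFin (hsub p.1).2 (p.2 i),
      (hsub p.1).1 (Finset.orderEmbOfFin_mem _ _ _)⟩, fun i i' hii' => by simpa using hii'⟩
  have hrange : ∀ p, Set.range (fun i => (enum p i : ℤ)) = (p.1 : Finset ℤ) := by
    intro p
    rw [← Finset.range_orderEmbOfFin p.1.1 (hsub p.1).2]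
    exact p.2.surjective.range_comp (p.1.1.orderEmbOfFin (hsub p.1).2)
  have hinj : Function.Injective enum := by
    rintro ⟨A, σ⟩ ⟨B, τ⟩ hp
    obtain rfl : A = B := by
      apply Subtype.ext
      rw [← Finset.coe_inj, ← hrange (A, σ), ← hrange (B, τ), hp]
    refine Prod.ext rfl (Equiv.ext fun i => ?_)
    have := congrArg Subtype.val (DFunLike.congr_fun hp i)
    exact (A.1.orderEmbOfFin (hsub A).2).injective this
  calc F.card * k.factorial = (Finset.univ : Finset (F × Equiv.Perm (Fin k))).card := by
        simp [Fintype.card_perm]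
    _ ≤ E.card := Finset.card_le_card_of_injOn enum
        (fun p _ => hE _ p.1 p.1.2 (hrange p)) hinj.injOn

open Classical in
/-- The number of `k`-subsets of `s` that are not `B_h`-sets, counted with their orderings. -/
theorem card_not_isBhg_mul_factorial_le (h k : ℕ) (s : Finset ℤ) :
    ((s.powersetCard k).filter fun A : Finset ℤ => ¬ IsBhg (A : Set ℤ) h 1).card * k.factorial ≤
      k ^ (2 * h) * s.card.descFactorial (k - 1) := by
  let P : Finset ((Fin h → Fin k) × (Fin h → Fin k)) := Finset.univ.filter fun p =>
    ∃ j, (Finset.univ.filter fun i => p.1 i = j).card ≠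
      (Finset.univ.filter fun i => p.2 i = j).card
  let E : (Fin h → Fin k) × (Fin h → Fin k) → Finset (Fin k ↪ s) := fun p =>
    Finset.univ.filter fun e => ∑ i, (e (p.1 i) : ℤ) = ∑ i, (e (p.2 i) : ℤ)
  have hE : ∀ p ∈ P, (E p).card ≤ s.card.descFactorial (k - 1) := by
    intro p hp
    obtain ⟨j, hj⟩ := (Finset.mem_filter.1 hp).2
    simpa using card_embedding_sum_eq_le s p.1 p.2 hj
  have hP : P.card ≤ k ^ (2 * h) := (Finset.card_le_univ P).trans_eq (by
    simp [two_mul, pow_add])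
  refine (card_mul_factorial_le_card_embedding (E := P.biUnion E)
    (Finset.filter_subset _ _) ?_).trans
    ((Finset.card_biUnion_le_card_mul P E _ hE).trans (Nat.mul_le_mul_right _ hP))
  intro e A hA heA
  obtain ⟨u, v, huv, hsum⟩ :=
    exists_sum_eq_of_not_isBhg (Finset.mem_filter.1 hA).2 heA.ge
  exact Finset.mem_biUnion.2 ⟨(u, v), by simpa [P] using huv, by simpa [E] using hsum⟩

/-- Clearing denominators: at most `C(n,k) · k^{2h} / (n-k+1)` of the `k`-subsets of
`{1, …, n}` are not `B_h`-sets. -/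
theorem choose_mul_le_countBh_mul_add (h : ℕ) {k n : ℕ} (hk : 1 ≤ k) (hkn : k ≤ n) :
    n.choose k * (n - k + 1) ≤ countBh h k n * (n - k + 1) + n.choose k * k ^ (2 * h) := by
  classical
  let s : Finset ℤ := Finset.Icc 1 n
  have hs : s.card = n := by simp [s]
  have hgood : countBh h k n =
      ((s.powersetCard k).filter fun A : Finset ℤ => IsBhg (A : Set ℤ) h 1).card := by
    rw [countBh, countBhg, ← Set.ncard_coe_finset]
    congr 1
    ext A
    simp [s, Finset.mem_powersetCard, ← Finset.coe_subset, and_assoc]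
  have hsplit := Finset.card_filter_add_card_filter_not (s := s.powersetCard k)
    (fun A : Finset ℤ => IsBhg (A : Set ℤ) h 1)
  have hbad := card_not_isBhg_mul_factorial_le h k s
  rw [← hgood, Finset.card_powersetCard, hs] at hsplit
  rw [hs] at hbad
  set b := ((s.powersetCard k).filter fun A : Finset ℤ => ¬ IsBhg (A : Set ℤ) h 1).card
  have hdesc : (n - k + 1) * n.descFactorial (k - 1) = k.factorial * n.choose k := by
    rw [← Nat.descFactorial_eq_factorial_mul_choose]
    obtain ⟨k, rfl⟩ := Nat.exists_eq_add_of_le' hk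
    rw [Nat.descFactorial_succ, Nat.add_sub_cancel, show n - (k + 1) + 1 = n - k by omega]
  have hle : b * (n - k + 1) ≤ n.choose k * k ^ (2 * h) := by
    refine Nat.le_of_mul_le_mul_right ?_ k.factorial_pos
    calc b * (n - k + 1) * k.factorial = (n - k + 1) * (b * k.factorial) := by ring
      _ ≤ (n - k + 1) * (k ^ (2 * h) * n.descFactorial (k - 1)) := Nat.mul_le_mul_left _ hbad
      _ = k ^ (2 * h) * ((n - k + 1) * n.descFactorial (k - 1)) := by ring
      _ = n.choose k * k ^ (2 * h) * k.factorial := by rw [hdesc]; ring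
  calc n.choose k * (n - k + 1) = countBh h k n * (n - k + 1) + b * (n - k + 1) := by
        rw [← hsplit, add_mul]
    _ ≤ _ := Nat.add_le_add_left hle _

/-- For `h ≥ 2` there is a constant `C > 0` depending only on `h` such that for all
positive integers `k ≤ n`, `C(n,k) - B_h(k,n) ≤ C · C(n,k) · k^{2h} / n`. -/
theorem choose_sub_countBh_le (h : ℕ) (hh : 2 ≤ h) :
    ∃ C : ℝ, 0 < C ∧ ∀ k n : ℕ, 1 ≤ k → k ≤ n →
      (n.choose k : ℝ) - (countBh h k n : ℝ) ≤
        C * (n.choose k : ℝ) * (k : ℝ) ^ (2 * h) / (n : ℝ) := by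
  refine ⟨2, two_pos, fun k n hk hkn => ?_⟩
  have hn : (0 : ℝ) < n := by exact_mod_cast hk.trans hkn
  rw [le_div_iff₀ hn]
  have hmain : (n.choose k : ℝ) * (n - k + 1) ≤
      countBh h k n * (n - k + 1) + n.choose k * (k : ℝ) ^ (2 * h) := by
    have := choose_mul_le_countBh_mul_add h hk hkn
    rify [hkn] at this
    exact this
  have hcount : (0 : ℝ) ≤ countBh h k n := Nat.cast_nonneg _
  have hchoose : (0 : ℝ) ≤ n.choose k := Nat.cast_nonneg _
  have hkpow : (k : ℝ) ≤ (k : ℝ) ^ (2 * h) :=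
    le_self_pow₀ (by exact_mod_cast hk) (by omega)
  rcases le_total (n : ℝ) (2 * k) with hnk | hnk
  · calc (n.choose k - countBh h k n : ℝ) * n ≤ n.choose k * n := by gcongr; linarith
      _ ≤ n.choose k * (2 * (k : ℝ) ^ (2 * h)) := by gcongr; linarith
      _ = 2 * n.choose k * (k : ℝ) ^ (2 * h) := by ring
  · rcases le_total (n.choose k : ℝ) (countBh h k n) with hle | hle
    · exact (mul_nonpos_of_nonpos_of_nonneg (sub_nonpos.2 hle) hn.le).trans (by positivity)
    · have : (n.choose k - countBh h k n : ℝ) * n ≤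
          (n.choose k - countBh h k n) * (2 * (n - k + 1)) :=
        mul_le_mul_of_nonneg_left (by linarith) (sub_nonneg.2 hle)
      linarith
end
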